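/- arXiv:2212.09959 — 2 statements merged into one kernel-verified Lean document; each statement's English description precedes it below -/
import Mathlib

section
/- Every element u of 𝔘(K) can be written as u = i_1^{a_1} i_2^{a_2} ⋯ i_n^{a_n} for some w∈W with ℓ(w)=n, some reduced word (i_1,…,i_n) of w, and some (a_1,…,a_n)∈K^n. Moreover w is uniquely determined by u: if u also equals j_1^{b_1}⋯j_m^{b_m} for a reduced word (j_1,…,j_m) of w′∈W and (b_1,…,b_m)∈K^m, then w = w′. (Thus 𝔘(K) is the disjoint union over w∈W of the sets 𝔘_w(K) of elements admitting such an expression over a reduced word of w.) -/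
open FreeMonoid

/-- The minimum of two elements of an additive subgroup of `ℝ`
(the "sum" in the tropical semifield `K`). -/
noncomputable def kmin {K : AddSubgroup ℝ} (a b : K) : K :=
  if (a : ℝ) ≤ (b : ℝ) then a else b

/-- Defining relations of the monoid `𝔘(K)` attached to a simply laced Coxeter matrix `M`
and the tropical semifield `K` (a subgroup of `(ℝ, +)` with sum `min` and product `+`). -/
inductive UKRel {I : Type*} (M : CoxeterMatrix I) (K : AddSubgroup ℝ) :
    FreeMonoid (I × K) → FreeMonoid (I × K) → Prop
  | comm (i j : I) (h : M i j = 2) (a b : K) :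
      UKRel M K (of (i, a) * of (j, b)) (of (j, b) * of (i, a))
  | braid (i j : I) (h : M i j = 3) (a b c : K) :
      UKRel M K (of (i, a) * of (j, b) * of (i, c))
        (of (j, b + c - kmin a c) * of (i, kmin a c) * of (j, a + b - kmin a c))
  | idem (i : I) (a b : K) :
      UKRel M K (of (i, a) * of (i, b)) (of (i, kmin a b))

/-- The monoid `𝔘(K)`. -/
noncomputable def UK {I : Type*} (M : CoxeterMatrix I) (K : AddSubgroup ℝ) :=
  (conGen (UKRel M K)).Quotient

noncomputable instance {I : Type*} (M : CoxeterMatrix I) (K : AddSubgroup ℝ) :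
    Monoid (UK M K) := Con.monoid _

/-- The generator `i^a` of `𝔘(K)`. -/
noncomputable def genU {I : Type*} (M : CoxeterMatrix I) (K : AddSubgroup ℝ)
    (i : I) (a : K) : UK M K :=
  (Con.mk' _) (of (i, a))

/-- The product `i₁^{a₁} ⋯ i_n^{a_n}` in `𝔘(K)` associated to a list of pairs. -/
noncomputable def prodU {I : Type*} (M : CoxeterMatrix I) (K : AddSubgroup ℝ)
    (ω : List (I × K)) : UK M K :=
  (ω.map fun p => genU M K p.1 p.2).prod

/-- `l` is a reduced word of `w`. -/
def IsRedWord {I W : Type*} [Group W] {M : CoxeterMatrix I} (cs : CoxeterSystem M W)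
    (w : W) (l : List I) : Prop :=
  cs.wordProd l = w ∧ l.length = cs.length w

/-- The set `𝒰(K) = 𝔘_{w₀}(K)` of products over reduced words of `w₀`. -/
noncomputable def calU {I W : Type*} [Group W] (M : CoxeterMatrix I) (K : AddSubgroup ℝ)
    (cs : CoxeterSystem M W) (w₀ : W) : Set (UK M K) :=
  {u | ∃ ω : List (I × K), IsRedWord cs w₀ (ω.map Prod.fst) ∧ u = prodU M K ω}

/-- The set `𝒰(K₊)`: products over reduced words of `w₀` with coefficients in `K₊ = K ∩ ℝ≥0`. -/
noncomputable def calUplus {I W : Type*} [Group W] (M : CoxeterMatrix I) (K : AddSubgroup ℝ)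
    (cs : CoxeterSystem M W) (w₀ : W) : Set (UK M K) :=
  {u | ∃ ω : List (I × K), IsRedWord cs w₀ (ω.map Prod.fst) ∧
        (∀ p ∈ ω, 0 ≤ (p.2 : ℝ)) ∧ u = prodU M K ω}

/-- Two vertices of the graph on `𝒰(K)` are joined by an edge. -/
noncomputable def UEdge {I W : Type*} [Group W] (M : CoxeterMatrix I) (K : AddSubgroup ℝ)
    (cs : CoxeterSystem M W) (w₀ : W) (H H' : UK M K) : Prop :=
  H ≠ H' ∧ ∃ (i : I) (b b' : K) (ω : List (I × K)),
    IsRedWord cs w₀ (i :: ω.map Prod.fst) ∧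
    H = genU M K i b * prodU M K ω ∧ H' = genU M K i b' * prodU M K ω

/-- `H` and `H'` are at distance `≤ k` in the graph on `𝒰(K)`. -/
noncomputable def DistLE {I W : Type*} [Group W] (M : CoxeterMatrix I) (K : AddSubgroup ℝ)
    (cs : CoxeterSystem M W) (w₀ : W) (k : ℕ) (H H' : UK M K) : Prop :=
  ∃ f : ℕ → UK M K, f 0 = H ∧ f k = H' ∧ (∀ t ≤ k, f t ∈ calU M K cs w₀) ∧
    ∀ t < k, f t = f (t + 1) ∨ UEdge M K cs w₀ (f t) (f (t + 1))

namespace CoxeterSystem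

variable {I W : Type*} [Group W] {M : CoxeterMatrix I}

/-- A family of involutions satisfying the commutation and braid relations of a simply laced
Coxeter matrix is liftable. -/
theorem isLiftable_of_simplyLaced (hM : ∀ i j : I, i ≠ j → M i j = 2 ∨ M i j = 3)
    {G : Type*} [Monoid G] (f : I → G) (hsq : ∀ i, f i * f i = 1)
    (hcomm : ∀ i j, M i j = 2 → f i * f j = f j * f i)
    (hbraid : ∀ i j, M i j = 3 → f i * f j * f i = f j * f i * f j) :
    M.IsLiftable f := by
  intro i j
  by_cases hij : i = j
  · subst hij
    simp [hsq]
  rcases hM i j hij with h | h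
  · rw [h, pow_two, mul_assoc, ← mul_assoc (f j), ← hcomm i j h, mul_assoc, hsq, mul_one, hsq]
  · have key : f i * f j * f i * (f j * f i * f j) = 1 := by
      rw [← hbraid i j h]
      simp only [mul_assoc]
      rw [← mul_assoc (f i) (f i), hsq, one_mul, ← mul_assoc (f j) (f j), hsq, one_mul, hsq]
    rw [h, pow_succ, pow_two]
    simpa only [mul_assoc] using key

theorem simple_comm (cs : CoxeterSystem M W) {i j : I} (h : M i j = 2) :
    cs.simple i * cs.simple j = cs.simple j * cs.simple i := by
  have := cs.simple_mul_simple_pow i j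
  rw [h, pow_two] at this
  have h2 := eq_inv_of_mul_eq_one_left this
  simpa using h2

theorem simple_braid (cs : CoxeterSystem M W) {i j : I} (h : M i j = 3) :
    cs.simple i * cs.simple j * cs.simple i = cs.simple j * cs.simple i * cs.simple j := by
  have := cs.simple_mul_simple_pow i j
  rw [h, pow_succ, pow_two] at this
  have h2 : cs.simple i * cs.simple j * cs.simple i *
      (cs.simple j * cs.simple i * cs.simple j) = 1 := by
    simpa only [mul_assoc] using this
  simpa [mul_assoc] using eq_inv_of_mul_eq_one_left h2

open Classical in
/-- The operator of the `i`-th simple reflection on coweight coordinates. -/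
noncomputable def coweightReflection (M : CoxeterMatrix I) (i : I) : Function.End (I → ℤ) :=
  fun f k => if k = i then -f i else if M i k = 3 then f k + f i else f k

theorem isLiftable_coweightReflection (hM : ∀ i j : I, i ≠ j → M i j = 2 ∨ M i j = 3) :
    M.IsLiftable (coweightReflection M) := by
  have hd : ∀ i, M i i = 1 := M.diagonal
  have hs : ∀ i j, M i j = M j i := M.symmetric
  apply isLiftable_of_simplyLaced hM
  · intro i
    funext f k
    change coweightReflection M i (coweightReflection M i f) k = f k
    simp only [coweightReflection]
    grind
  · intro i j h
    funext f k
    change coweightReflection M i (coweightReflection M j f) k =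
      coweightReflection M j (coweightReflection M i f) k
    simp only [coweightReflection]
    grind
  · intro i j h
    funext f k
    change coweightReflection M i (coweightReflection M j (coweightReflection M i f)) k =
      coweightReflection M j (coweightReflection M i (coweightReflection M j f)) k
    simp only [coweightReflection]
    grind

theorem simple_injective_of_simplyLaced (cs : CoxeterSystem M W)
    (hM : ∀ i j : I, i ≠ j → M i j = 2 ∨ M i j = 3) : Function.Injective cs.simple := by
  classical
  intro i j hij
  by_contra hne
  have h := congrArg (cs.lift ⟨_, isLiftable_coweightReflection hM⟩) hij
  rw [cs.lift_apply_simple, cs.lift_apply_simple] at h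
  have h2 := congrFun (congrFun h (Pi.single i 1)) i
  have hs : M i j = M j i := M.symmetric i j
  simp [coweightReflection, hne, Ne.symm hne] at h2

open Classical in
/-- The operator of the `i`-th simple reflection on pairs of a group element and a parity:
it conjugates the element and flips the parity if the element is `s i`. -/
noncomputable def signedConj (cs : CoxeterSystem M W) (i : I) : Function.End (W × ZMod 2) :=
  fun p => (cs.simple i * p.1 * cs.simple i, p.2 + if p.1 = cs.simple i then 1 else 0)

open Classical in
theorem signedConj_apply (cs : CoxeterSystem M W) (i : I) (t : W) (e : ZMod 2) :
    cs.signedConj i (t, e) =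
      (cs.simple i * t * cs.simple i, e + if t = cs.simple i then 1 else 0) :=
  rfl

theorem isLiftable_signedConj (cs : CoxeterSystem M W)
    (hM : ∀ i j : I, i ≠ j → M i j = 2 ∨ M i j = 3) : M.IsLiftable cs.signedConj := by
  classical
  have conj_eq : ∀ (i : I) (t x : W), cs.simple i * t * cs.simple i = x ↔
      t = cs.simple i * x * cs.simple i := by
    intro i t x
    constructor <;> rintro rfl <;> simp [mul_assoc]
  apply isLiftable_of_simplyLaced hM
  · rintro i
    funext ⟨t, e⟩
    change cs.signedConj i (cs.signedConj i (t, e)) = (t, e)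
    refine Prod.ext (by simp [signedConj_apply, mul_assoc]) ?_
    simp only [signedConj_apply, conj_eq, cs.simple_mul_simple_self, one_mul]
    split_ifs
    · rw [add_assoc, CharTwo.add_self_eq_zero, add_zero]
    · simp
  · intro i j h
    have hc := cs.simple_comm h
    funext ⟨t, e⟩
    change cs.signedConj i (cs.signedConj j (t, e)) = cs.signedConj j (cs.signedConj i (t, e))
    have h1 : cs.simple j * cs.simple i * cs.simple j = cs.simple i := by
      rw [← hc, mul_assoc, cs.simple_mul_simple_self, mul_one]
    have h2 : cs.simple i * cs.simple j * cs.simple i = cs.simple j := by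
      rw [hc, mul_assoc, cs.simple_mul_simple_self, mul_one]
    refine Prod.ext ?_ (by simp only [signedConj_apply, conj_eq, h1, h2]; ring)
    simp only [signedConj_apply]
    calc cs.simple i * (cs.simple j * t * cs.simple j) * cs.simple i
        = (cs.simple i * cs.simple j) * t * (cs.simple j * cs.simple i) := by
          simp only [mul_assoc]
      _ = (cs.simple j * cs.simple i) * t * (cs.simple i * cs.simple j) := by rw [hc]
      _ = _ := by simp only [mul_assoc]
  · intro i j h
    have hb := cs.simple_braid h
    funext ⟨t, e⟩
    change cs.signedConj i (cs.signedConj j (cs.signedConj i (t, e))) =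
      cs.signedConj j (cs.signedConj i (cs.signedConj j (t, e)))
    have h1 : cs.simple i * (cs.simple j * cs.simple i * cs.simple j) * cs.simple i =
        cs.simple j := by
      rw [← hb]
      simp [mul_assoc]
    have h2 : cs.simple j * (cs.simple i * cs.simple j * cs.simple i) * cs.simple j =
        cs.simple i := by
      rw [hb]
      simp [mul_assoc]
    refine Prod.ext ?_ (by simp only [signedConj_apply, conj_eq, h1, h2]; simp only [hb]; ring)
    simp only [signedConj_apply]
    calc _ = (cs.simple i * cs.simple j * cs.simple i) * t *
          (cs.simple i * cs.simple j * cs.simple i) := by simp only [mul_assoc]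
      _ = _ := by rw [hb]; simp only [mul_assoc]

/-- The parity of the number of occurrences of `t` in the left inversion sequence of any word
representing `w`. -/
noncomputable def inversionParity (cs : CoxeterSystem M W)
    (hM : ∀ i j : I, i ≠ j → M i j = 2 ∨ M i j = 3) (w t : W) : ZMod 2 :=
  (cs.lift ⟨_, cs.isLiftable_signedConj hM⟩ w⁻¹ (t, 0)).2

section Parity

variable (cs : CoxeterSystem M W) (hM : ∀ i j : I, i ≠ j → M i j = 2 ∨ M i j = 3)

theorem lift_signedConj_snd (w t : W) (e : ZMod 2) :
    (cs.lift ⟨_, cs.isLiftable_signedConj hM⟩ w (t, e)).2 =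
      e + (cs.lift ⟨_, cs.isLiftable_signedConj hM⟩ w (t, 0)).2 := by
  induction w using cs.simple_induction_right generalizing t e with
  | one => simp [Function.End.one_def]
  | mul_simple_right w i ih =>
    rw [map_mul, cs.lift_apply_simple]
    change (cs.lift ⟨_, cs.isLiftable_signedConj hM⟩ w (cs.signedConj i (t, e))).2 =
      e + (cs.lift ⟨_, cs.isLiftable_signedConj hM⟩ w (cs.signedConj i (t, 0))).2
    simp only [signedConj_apply]
    rw [ih, ih _ (0 + _)]
    ring

theorem inversionParity_one (t : W) : cs.inversionParity hM 1 t = 0 := by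
  simp [inversionParity, Function.End.one_def]

open Classical in
theorem inversionParity_simple_mul (i : I) (w t : W) :
    cs.inversionParity hM (cs.simple i * w) t =
      (if t = cs.simple i then 1 else 0) +
        cs.inversionParity hM w (cs.simple i * t * cs.simple i) := by
  rw [inversionParity, mul_inv_rev, cs.inv_simple, map_mul, cs.lift_apply_simple]
  change (cs.lift ⟨_, cs.isLiftable_signedConj hM⟩ w⁻¹ (cs.signedConj i (t, 0))).2 = _
  simp only [signedConj_apply, zero_add]
  rw [lift_signedConj_snd cs hM]
  rfl

theorem mem_leftInvSeq_of_inversionParity_ne_zero (l : List I) (t : W)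
    (h : cs.inversionParity hM (cs.wordProd l) t ≠ 0) : t ∈ cs.leftInvSeq l := by
  induction l generalizing t with
  | nil => simp [inversionParity_one] at h
  | cons i l ih =>
    rw [wordProd_cons, inversionParity_simple_mul] at h
    rw [leftInvSeq, List.mem_cons, List.mem_map]
    by_cases ht : t = cs.simple i
    · exact .inl ht
    · rw [if_neg ht, zero_add] at h
      exact .inr ⟨_, ih _ h, by simp [mul_assoc]⟩

theorem length_mul_lt_of_inversionParity_ne_zero {w t : W}
    (h : cs.inversionParity hM w t ≠ 0) : cs.length (t * w) < cs.length w := by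
  obtain ⟨l, hl, rfl⟩ := cs.exists_isReduced w
  exact (cs.isLeftInversion_of_mem_leftInvSeq hl
    (cs.mem_leftInvSeq_of_inversionParity_ne_zero hM l t h)).2

theorem inversionParity_simple_mul_self (i : I) (w : W) :
    cs.inversionParity hM (cs.simple i * w) (cs.simple i) =
      1 + cs.inversionParity hM w (cs.simple i) := by
  rw [inversionParity_simple_mul, if_pos rfl]
  simp

theorem isLeftDescent_iff_inversionParity_ne_zero (w : W) (i : I) :
    cs.IsLeftDescent w i ↔ cs.inversionParity hM w (cs.simple i) ≠ 0 := by
  refine ⟨fun h h0 => ?_, fun h => cs.length_mul_lt_of_inversionParity_ne_zero hM h⟩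
  have h1 := cs.length_mul_lt_of_inversionParity_ne_zero hM (w := cs.simple i * w)
    (t := cs.simple i) (by rw [inversionParity_simple_mul_self, h0]; decide)
  rw [cs.simple_mul_simple_cancel_left] at h1
  exact lt_asymm h h1

theorem isLeftDescent_simple_mul_self (w : W) (i : I) :
    cs.IsLeftDescent (cs.simple i * w) i ↔ ¬ cs.IsLeftDescent w i := by
  rw [isLeftDescent_iff_not_isLeftDescent_mul, simple_mul_simple_cancel_left]

include hM in
theorem isLeftDescent_simple_mul_of_comm {i j : I} (h : M i j = 2) (w : W) :
    cs.IsLeftDescent (cs.simple i * w) j ↔ cs.IsLeftDescent w j := by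
  have hij : j ≠ i := by
    rintro rfl
    simp at h
  rw [isLeftDescent_iff_inversionParity_ne_zero cs hM,
    isLeftDescent_iff_inversionParity_ne_zero cs hM, inversionParity_simple_mul,
    if_neg ((cs.simple_injective_of_simplyLaced hM).ne hij), zero_add, cs.simple_comm h,
    simple_mul_simple_cancel_right]

include hM in
/-- The left descents along the cosets of a rank two parabolic subgroup of type `A₂`, in terms of
the predicate `R` that `s i * s j * s i` is a left inversion. -/
theorem exists_inversion_of_braid {i j : I} (h : M i j = 3) : ∃ R : W → Prop, ∀ w,
    (cs.IsLeftDescent (cs.simple i * w) j ↔ R w) ∧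
    (cs.IsLeftDescent (cs.simple j * w) i ↔ R w) ∧
    (R (cs.simple i * w) ↔ cs.IsLeftDescent w j) ∧
    (R (cs.simple j * w) ↔ cs.IsLeftDescent w i) ∧
    (cs.IsLeftDescent w i → cs.IsLeftDescent w j → R w) ∧
    (R w → cs.IsLeftDescent w i ∨ cs.IsLeftDescent w j) := by
  have hij : i ≠ j := by
    rintro rfl
    simp at h
  have hne := (cs.simple_injective_of_simplyLaced hM).ne hij
  have hb := cs.simple_braid h
  set r := cs.simple i * cs.simple j * cs.simple i with hr
  have hri : cs.simple i * r * cs.simple i = cs.simple j := by simp [hr, mul_assoc]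
  have hrj : cs.simple j * r * cs.simple j = cs.simple i := by simp [hb, mul_assoc]
  have hrnei : r ≠ cs.simple i := by
    intro h1
    rw [h1] at hri
    simp at hri
    exact hne hri
  have hrnej : r ≠ cs.simple j := by
    intro h1
    rw [h1] at hrj
    simp at hrj
    exact hne hrj.symm
  have D := cs.isLeftDescent_iff_inversionParity_ne_zero hM
  have h1 : ∀ w, cs.inversionParity hM (cs.simple i * w) (cs.simple j) =
      cs.inversionParity hM w r := by
    intro w
    rw [inversionParity_simple_mul, if_neg hne.symm, zero_add]
  have h2 : ∀ w, cs.inversionParity hM (cs.simple j * w) (cs.simple i) =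
      cs.inversionParity hM w r := by
    intro w
    rw [inversionParity_simple_mul, if_neg hne, zero_add, ← hb]
  have h3 : ∀ w, cs.inversionParity hM (cs.simple i * w) r =
      cs.inversionParity hM w (cs.simple j) := by
    intro w
    rw [inversionParity_simple_mul, if_neg hrnei, zero_add, hri]
  have h4 : ∀ w, cs.inversionParity hM (cs.simple j * w) r =
      cs.inversionParity hM w (cs.simple i) := by
    intro w
    rw [inversionParity_simple_mul, if_neg hrnej, zero_add, hrj]
  have hrw : ∀ w, r * w = cs.simple i * (cs.simple j * (cs.simple i * w)) := by
    intro w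
    simp only [hr, mul_assoc]
  refine ⟨fun w => cs.inversionParity hM w r ≠ 0, fun w => ?_⟩
  have e1 : cs.IsLeftDescent (cs.simple i * w) j ↔ cs.inversionParity hM w r ≠ 0 := by
    rw [D, h1]
  have e2 : cs.IsLeftDescent (cs.simple j * (cs.simple i * w)) i ↔ cs.IsLeftDescent w j := by
    rw [D, D, h2, h3]
  refine ⟨e1, by rw [D, h2], by beta_reduce; rw [D, h3], by beta_reduce; rw [D, h4], ?_, ?_⟩
  · intro hi hj h0
    have hlt := cs.length_mul_lt_of_inversionParity_ne_zero hM (w := r * w) (t := r) (by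
      rw [hrw, h3, inversionParity_simple_mul_self, h1, h0]; decide)
    rw [← mul_assoc, show r * r = 1 by simp [hr, mul_assoc], one_mul, hrw] at hlt
    have a1 := cs.isLeftDescent_iff.1 hi
    have a2 := cs.not_isLeftDescent_iff.1 (mt e1.1 (not_not.2 h0))
    have a3 := cs.isLeftDescent_iff.1 (e2.2 hj)
    omega
  · intro h0
    by_contra! hn
    have hlt := cs.length_mul_lt_of_inversionParity_ne_zero hM h0
    rw [hrw] at hlt
    have a1 := cs.not_isLeftDescent_iff.1 hn.1
    have a2 := cs.isLeftDescent_iff.1 (e1.2 h0)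
    have a3 := cs.not_isLeftDescent_iff.1 (mt e2.1 hn.2)
    omega

end Parity

open Classical in
/-- The Demazure operator: left multiplication by `s i` when this increases the length. -/
noncomputable def demazure (cs : CoxeterSystem M W) (i : I) : Function.End W :=
  fun w => if cs.IsLeftDescent w i then w else cs.simple i * w

theorem demazure_mul_self (cs : CoxeterSystem M W) (i : I) :
    cs.demazure i * cs.demazure i = cs.demazure i := by
  funext w
  change cs.demazure i (cs.demazure i w) = cs.demazure i w
  have := cs.isLeftDescent_simple_mul_self w i
  simp only [demazure]
  split_ifs <;> simp_all

theorem demazure_comm (cs : CoxeterSystem M W)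
    (hM : ∀ i j : I, i ≠ j → M i j = 2 ∨ M i j = 3) {i j : I} (h : M i j = 2) :
    cs.demazure i * cs.demazure j = cs.demazure j * cs.demazure i := by
  funext w
  change cs.demazure i (cs.demazure j w) = cs.demazure j (cs.demazure i w)
  have h1 := cs.isLeftDescent_simple_mul_of_comm hM h w
  have h2 := cs.isLeftDescent_simple_mul_of_comm hM (i := j) (j := i) (M.symmetric j i ▸ h) w
  have h3 : cs.simple i * (cs.simple j * w) = cs.simple j * (cs.simple i * w) := by
    rw [← mul_assoc, cs.simple_comm h, mul_assoc]
  unfold demazure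
  by_cases di : cs.IsLeftDescent w i <;> by_cases dj : cs.IsLeftDescent w j <;> simp_all

theorem demazure_braid (cs : CoxeterSystem M W)
    (hM : ∀ i j : I, i ≠ j → M i j = 2 ∨ M i j = 3) {i j : I} (h : M i j = 3) :
    cs.demazure i * cs.demazure j * cs.demazure i =
      cs.demazure j * cs.demazure i * cs.demazure j := by
  funext w
  change cs.demazure i (cs.demazure j (cs.demazure i w)) =
    cs.demazure j (cs.demazure i (cs.demazure j w))
  obtain ⟨R, hR⟩ := cs.exists_inversion_of_braid hM h
  have hi := fun w => cs.isLeftDescent_simple_mul_self w i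
  have hj := fun w => cs.isLeftDescent_simple_mul_self w j
  have hb : cs.simple i * (cs.simple j * (cs.simple i * w)) =
      cs.simple j * (cs.simple i * (cs.simple j * w)) := by
    simpa only [mul_assoc] using congrArg (· * w) (cs.simple_braid h)
  have r1 := fun w => (hR w).1
  have r2 := fun w => (hR w).2.1
  have r3 := fun w => (hR w).2.2.1
  have r4 := fun w => (hR w).2.2.2.1
  have r5 := (hR w).2.2.2.2
  unfold demazure
  by_cases di : cs.IsLeftDescent w i <;> by_cases dj : cs.IsLeftDescent w j <;>
    by_cases dr : R w <;> simp_all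

end CoxeterSystem

section UK

variable {I W : Type*} [Group W] {M : CoxeterMatrix I} {K : AddSubgroup ℝ}

theorem genU_comm {i j : I} (h : M i j = 2) (a b : K) :
    genU M K i a * genU M K j b = genU M K j b * genU M K i a :=
  (Con.eq _).2 (ConGen.Rel.of _ _ (UKRel.comm i j h a b))

theorem genU_braid {i j : I} (h : M i j = 3) (a b c : K) :
    genU M K i a * genU M K j b * genU M K i c =
      genU M K j (b + c - kmin a c) * genU M K i (kmin a c) * genU M K j (a + b - kmin a c) :=
  (Con.eq _).2 (ConGen.Rel.of _ _ (UKRel.braid i j h a b c))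

theorem genU_idem (i : I) (a b : K) :
    genU M K i a * genU M K i b = genU M K i (kmin a b) :=
  (Con.eq _).2 (ConGen.Rel.of _ _ (UKRel.idem i a b))

theorem prodU_cons (p : I × K) (ω : List (I × K)) :
    prodU M K (p :: ω) = genU M K p.1 p.2 * prodU M K ω := by
  simp [prodU]

theorem prodU_surjective (u : UK M K) : ∃ ω : List (I × K), u = prodU M K ω := by
  obtain ⟨l, rfl⟩ := Con.mk'_surjective u
  induction l using FreeMonoid.inductionOn' with
  | one => exact ⟨[], rfl⟩
  | of_mul p l ih =>
    obtain ⟨ω, hω⟩ := ih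
    exact ⟨p :: ω, by rw [prodU_cons, ← hω]; rfl⟩

/-- The homomorphism from `𝔘(K)` to the monoid generated by the Demazure operators. -/
noncomputable def UK.toDemazure (cs : CoxeterSystem M W)
    (hM : ∀ i j : I, i ≠ j → M i j = 2 ∨ M i j = 3) (K : AddSubgroup ℝ) :
    UK M K →* Function.End W :=
  Con.lift _ (FreeMonoid.lift fun p : I × K => cs.demazure p.1) <| Con.conGen_le.2 <| by
    rintro x y (⟨i, j, h, a, b⟩ | ⟨i, j, h, a, b, c⟩ | ⟨i, a, b⟩)
    · simpa [Con.ker_rel] using cs.demazure_comm hM h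
    · simpa [Con.ker_rel] using cs.demazure_braid hM h
    · simpa [Con.ker_rel] using cs.demazure_mul_self i

theorem UK.toDemazure_genU (cs : CoxeterSystem M W)
    (hM : ∀ i j : I, i ≠ j → M i j = 2 ∨ M i j = 3) (i : I) (a : K) :
    UK.toDemazure cs hM K (genU M K i a) = cs.demazure i := by
  change FreeMonoid.lift (fun p : I × K => cs.demazure p.1) (of (i, a)) = _
  simp

theorem isRedWord_cons_iff (cs : CoxeterSystem M W) (w : W) (i : I) (l : List I) :
    IsRedWord cs w (i :: l) ↔
      cs.IsLeftDescent w i ∧ IsRedWord cs (cs.simple i * w) l := by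
  simp only [IsRedWord, cs.wordProd_cons, List.length_cons, cs.isLeftDescent_iff]
  constructor
  · rintro ⟨rfl, h⟩
    have h1 := cs.length_wordProd_le l
    have h2 := cs.length_simple_mul (cs.wordProd l) i
    rw [cs.simple_mul_simple_cancel_left]
    exact ⟨by omega, rfl, by omega⟩
  · rintro ⟨h, h1, h2⟩
    exact ⟨by rw [h1, cs.simple_mul_simple_cancel_left], by omega⟩

theorem UK.toDemazure_prodU (cs : CoxeterSystem M W)
    (hM : ∀ i j : I, i ≠ j → M i j = 2 ∨ M i j = 3) (w : W) (ω : List (I × K))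
    (h : IsRedWord cs w (ω.map Prod.fst)) :
    UK.toDemazure cs hM K (prodU M K ω) (1 : W) = w := by
  induction ω generalizing w with
  | nil =>
    change UK.toDemazure cs hM K 1 (1 : W) = w
    rw [map_one]
    exact h.1
  | cons p ω ih =>
    obtain ⟨hd, hr⟩ := (isRedWord_cons_iff cs w p.1 _).1 h
    rw [prodU_cons, map_mul, UK.toDemazure_genU]
    change cs.demazure p.1 (UK.toDemazure cs hM K (prodU M K ω) (1 : W)) = w
    rw [ih _ hr, CoxeterSystem.demazure, if_neg, cs.simple_mul_simple_cancel_left]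
    rwa [cs.isLeftDescent_simple_mul_self, not_not]

theorem exists_prodU_eq_genU_mul (cs : CoxeterSystem M W)
    (hM : ∀ i j : I, i ≠ j → M i j = 2 ∨ M i j = 3) {w : W} {i : I} (ω : List (I × K))
    (h : IsRedWord cs w (ω.map Prod.fst)) (hi : cs.IsLeftDescent w i) :
    ∃ (b : K) (ω' : List (I × K)), IsRedWord cs (cs.simple i * w) (ω'.map Prod.fst) ∧
      prodU M K ω = genU M K i b * prodU M K ω' := by
  induction hn : cs.length w using Nat.strong_induction_on generalizing w i ω with
  | _ n ih =>
  subst hn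
  rcases ω with _ | ⟨⟨j, c⟩, ω⟩
  · obtain rfl : w = 1 := by simpa using h.1.symm
    exact absurd hi (cs.not_isLeftDescent_one i)
  obtain ⟨hj, hr⟩ := (isRedWord_cons_iff cs w j _).1 h
  rw [prodU_cons]
  by_cases hij : i = j
  · subst hij
    exact ⟨c, ω, hr, rfl⟩
  rcases hM i j hij with hm | hm
  · have hm' : M j i = 2 := M.symmetric j i ▸ hm
    obtain ⟨b, ω₂, hr₂, he⟩ := ih _ hj ω hr
      ((cs.isLeftDescent_simple_mul_of_comm hM hm' w).2 hi) rfl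
    refine ⟨b, (j, c) :: ω₂, (isRedWord_cons_iff cs _ j _).2
      ⟨(cs.isLeftDescent_simple_mul_of_comm hM hm w).2 hj, ?_⟩, ?_⟩
    · rwa [← mul_assoc, ← cs.simple_comm hm, mul_assoc]
    · rw [he, prodU_cons, ← mul_assoc, ← mul_assoc, genU_comm hm]
  · have hm' : M j i = 3 := M.symmetric j i ▸ hm
    obtain ⟨R, hR⟩ := cs.exists_inversion_of_braid hM hm
    have hRw := (hR w).2.2.2.2.1 hi hj
    have hi₁ : cs.IsLeftDescent (cs.simple j * w) i := (hR w).2.1.2 hRw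
    have hj₁ : cs.IsLeftDescent (cs.simple i * w) j := (hR w).1.2 hRw
    have hj₂ : cs.IsLeftDescent (cs.simple i * (cs.simple j * w)) j :=
      (hR _).1.2 ((hR w).2.2.2.1.2 hi)
    have hi₂ : cs.IsLeftDescent (cs.simple j * (cs.simple i * w)) i :=
      (hR _).2.1.2 ((hR w).2.2.1.2 hj)
    obtain ⟨b, ω₂, hr₂, he₂⟩ := ih _ hj ω hr hi₁ rfl
    obtain ⟨d, ω₃, hr₃, he₃⟩ := ih _ (hi₁.trans hj) ω₂ hr₂ hj₂ rfl
    refine ⟨b + d - kmin c d, (j, kmin c d) :: (i, c + b - kmin c d) :: ω₃, ?_, ?_⟩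
    · refine (isRedWord_cons_iff cs _ j _).2 ⟨hj₁, (isRedWord_cons_iff cs _ i _).2 ⟨hi₂, ?_⟩⟩
      have hb := congrArg (· * w) (cs.simple_braid hm)
      simp only [mul_assoc] at hb
      rwa [hb]
    · rw [he₂, he₃, prodU_cons, prodU_cons]
      simp only [← mul_assoc]
      rw [genU_braid hm']

theorem exists_isRedWord_prodU_eq (cs : CoxeterSystem M W)
    (hM : ∀ i j : I, i ≠ j → M i j = 2 ∨ M i j = 3) (ω : List (I × K)) :
    ∃ (w : W) (ω' : List (I × K)),
      IsRedWord cs w (ω'.map Prod.fst) ∧ prodU M K ω = prodU M K ω' := by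
  induction ω with
  | nil => exact ⟨1, [], by simp [IsRedWord], rfl⟩
  | cons p ω ih =>
    obtain ⟨w, ω₁, hr, he⟩ := ih
    obtain ⟨i, a⟩ := p
    rw [prodU_cons, he]
    by_cases hi : cs.IsLeftDescent w i
    · obtain ⟨b, ω₂, hr₂, he₂⟩ := exists_prodU_eq_genU_mul cs hM ω₁ hr hi
      refine ⟨w, (i, kmin a b) :: ω₂, (isRedWord_cons_iff cs w i _).2 ⟨hi, hr₂⟩, ?_⟩
      rw [he₂, prodU_cons, ← mul_assoc, genU_idem]
    · refine ⟨cs.simple i * w, (i, a) :: ω₁, (isRedWord_cons_iff cs _ i _).2 ⟨?_, ?_⟩, ?_⟩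
      · rwa [cs.isLeftDescent_simple_mul_self]
      · rwa [cs.simple_mul_simple_cancel_left]
      · rw [prodU_cons]

end UK

/-- **Decomposition `𝔘(K) = ⨆_w 𝔘_w(K)`** (Lusztig, "Half circles on flag manifolds over
a semifield", no. 4).  Every `u ∈ 𝔘(K)` can be written `u = i₁^{a₁} ⋯ i_n^{a_n}` over a
reduced word of some `w ∈ W`, and the element `w` is uniquely determined by `u`. -/
theorem exists_unique_w
    {I W : Type*} [Finite I] [Nonempty I] [Group W] [Finite W]
    (M : CoxeterMatrix I) (hM : ∀ i j : I, i ≠ j → M i j = 2 ∨ M i j = 3)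
    (cs : CoxeterSystem M W)
    (K : AddSubgroup ℝ) (hK : K ≠ ⊥)
    (u : UK M K) :
    (∃ (w : W) (ω : List (I × K)), IsRedWord cs w (ω.map Prod.fst) ∧ u = prodU M K ω) ∧
    ∀ (w w' : W) (ω ω' : List (I × K)),
      IsRedWord cs w (ω.map Prod.fst) → IsRedWord cs w' (ω'.map Prod.fst) →
      u = prodU M K ω → u = prodU M K ω' → w = w' := by
  refine ⟨?_, fun w w' ω ω' h h' hu hu' => ?_⟩
  · obtain ⟨ω₀, rfl⟩ := prodU_surjective u
    exact exists_isRedWord_prodU_eq cs hM ω₀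
  · rw [← UK.toDemazure_prodU cs hM w ω h, ← UK.toDemazure_prodU cs hM w' ω' h', ← hu, ← hu']
end

section
/- Fix a reduced word (i_1,…,i_ν) of w₀ and k∈{1,…,ν}. For i∈I let i^!∈I be defined by s_i w₀ = w₀ s_{i^!}. Then (i_k, i_{k+1},…,i_ν, i_1^!, i_2^!,…,i_{k−1}^!) is a reduced word of w₀. Let H∈𝒰(K_+) satisfy χ_{w₀}(H) = g_{i_{k−1}} g_{i_{k−2}} ⋯ g_{i_2} g_{i_1} in 𝔘₁, and write H = i_k^{c_1} i_{k+1}^{c_2} ⋯ i_ν^{c_{ν−k+1}} (i_1^!)^{c_{ν−k+2}} (i_2^!)^{c_{ν−k+3}} ⋯ (i_{k−1}^!)^{c_ν} with c_1,…,c_ν∈K_+ (such an expression exists). Then c_1 > 0, and the element H̃ := i_k^{0} i_{k+1}^{c_2} ⋯ i_ν^{c_{ν−k+1}} (i_1^!)^{c_{ν−k+2}} ⋯ (i_{k−1}^!)^{c_ν} of 𝒰(K_+) satisfies χ_{w₀}(H̃) = g_{i_k} g_{i_{k−1}} ⋯ g_{i_2} g_{i_1}. -/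
open FreeMonoid

/-- Defining relations of the 0-Hecke monoid `𝔘₁` of a simply laced Coxeter matrix. -/
inductive HeckeRel {I : Type*} (M : CoxeterMatrix I) : FreeMonoid I → FreeMonoid I → Prop
  | comm (i j : I) (h : M i j = 2) : HeckeRel M (of i * of j) (of j * of i)
  | braid (i j : I) (h : M i j = 3) : HeckeRel M (of i * of j * of i) (of j * of i * of j)
  | idem (i : I) : HeckeRel M (of i * of i) (of i)

/-- The 0-Hecke monoid `𝔘₁ = 𝔘({1})`. -/
def Hecke {I : Type*} (M : CoxeterMatrix I) := (conGen (HeckeRel M)).Quotient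

instance {I : Type*} (M : CoxeterMatrix I) : Monoid (Hecke M) := Con.monoid _

/-- The generator `g_i` of the 0-Hecke monoid. -/
def genH {I : Type*} (M : CoxeterMatrix I) (i : I) : Hecke M := (Con.mk' _) (of i)

/-- The product `g_{i₁} g_{i₂} ⋯ g_{i_n}` in the 0-Hecke monoid. -/
def prodH {I : Type*} (M : CoxeterMatrix I) (l : List I) : Hecke M :=
  (l.map fun i => genH M i).prod

/-- The list of indices (in order) whose coefficient vanishes, in a word in the
generators of `𝔘(K)`. -/
noncomputable def zeroList {I : Type*} {K : AddSubgroup ℝ} : List (I × K) → List I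
  | [] => []
  | p :: rest => if (p.2 : ℝ) = 0 then p.1 :: zeroList rest else zeroList rest

/-- The zero-subword of a representation `i₁^{a₁} ⋯ i_n^{a_n}`, as an element of the
0-Hecke monoid `𝔘₁`: the product `g_{i_{j₁}} ⋯ g_{i_{j_k}}` over the positions
`j₁ < ⋯ < j_k` where `a_j = 0`. -/
noncomputable def chiRep {I : Type*} (M : CoxeterMatrix I) {K : AddSubgroup ℝ}
    (ω : List (I × K)) : Hecke M :=
  prodH M (zeroList ω)

/-- The image of the generator `i^a` under the extension of the zero-subword map to all of
`𝔘(K)`: a negative exponent is sent to the absorbing element. -/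
noncomputable def chiGen {I : Type*} (M : CoxeterMatrix I) {K : AddSubgroup ℝ} (p : I × K) :
    WithZero (Hecke M) :=
  if (p.2 : ℝ) < 0 then 0 else if (p.2 : ℝ) = 0 then (genH M p.1 : WithZero (Hecke M)) else 1

lemma genH_comm {I : Type*} (M : CoxeterMatrix I) {i j : I} (h : M i j = 2) :
    genH M i * genH M j = genH M j * genH M i :=
  (Con.eq _).2 (ConGen.Rel.of _ _ (HeckeRel.comm i j h))

lemma genH_braid {I : Type*} (M : CoxeterMatrix I) {i j : I} (h : M i j = 3) :
    genH M i * genH M j * genH M i = genH M j * genH M i * genH M j :=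
  (Con.eq _).2 (ConGen.Rel.of _ _ (HeckeRel.braid i j h))

lemma genH_idem {I : Type*} (M : CoxeterMatrix I) (i : I) :
    genH M i * genH M i = genH M i :=
  (Con.eq _).2 (ConGen.Rel.of _ _ (HeckeRel.idem i))

lemma coe_kmin {K : AddSubgroup ℝ} (a b : K) : ((kmin a b : K) : ℝ) = min (a : ℝ) b := by
  unfold kmin
  split_ifs with h
  · exact (min_eq_left h).symm
  · exact (min_eq_right (not_le.1 h).le).symm

lemma chiGen_of_neg {I : Type*} (M : CoxeterMatrix I) {K : AddSubgroup ℝ} (i : I) {a : K}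
    (h : (a : ℝ) < 0) : chiGen M (i, a) = 0 := by
  simp [chiGen, h]

lemma chiGen_of_eq_zero {I : Type*} (M : CoxeterMatrix I) {K : AddSubgroup ℝ} (i : I) {a : K}
    (h : (a : ℝ) = 0) : chiGen M (i, a) = (genH M i : WithZero (Hecke M)) := by
  simp only [chiGen, h, lt_irrefl, if_true, if_false]

lemma chiGen_of_pos {I : Type*} (M : CoxeterMatrix I) {K : AddSubgroup ℝ} (i : I) {a : K}
    (h : 0 < (a : ℝ)) : chiGen M (i, a) = 1 := by
  simp [chiGen, h.not_gt, h.ne']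

lemma chiGen_comm {I : Type*} (M : CoxeterMatrix I) {K : AddSubgroup ℝ} {i j : I}
    (h : M i j = 2) (a b : K) :
    chiGen M (i, a) * chiGen M (j, b) = chiGen M (j, b) * chiGen M (i, a) := by
  simp only [chiGen]
  split_ifs <;> simp [← WithZero.coe_mul, genH_comm M h]

lemma chiGen_idem {I : Type*} (M : CoxeterMatrix I) {K : AddSubgroup ℝ} (i : I) (a b : K) :
    chiGen M (i, a) * chiGen M (i, b) = chiGen M (i, kmin a b) := by
  simp only [chiGen, coe_kmin]
  rcases min_cases (a : ℝ) b with ⟨h, _⟩ | ⟨h, _⟩ <;> rw [h] <;> split_ifs <;>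
    first
    | (exfalso; linarith)
    | (exfalso; grind)
    | simp [← WithZero.coe_mul, genH_idem]

lemma chiGen_braid {I : Type*} (M : CoxeterMatrix I) {K : AddSubgroup ℝ} {i j : I}
    (h : M i j = 3) (a b c : K) :
    chiGen M (i, a) * chiGen M (j, b) * chiGen M (i, c) =
      chiGen M (j, b + c - kmin a c) * chiGen M (i, kmin a c) *
        chiGen M (j, a + b - kmin a c) := by
  have hm := coe_kmin a c
  have hl : ((b + c - kmin a c : K) : ℝ) = b + c - min (a : ℝ) c := by simp [hm]
  have hr : ((a + b - kmin a c : K) : ℝ) = a + b - min (a : ℝ) c := by simp [hm]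
  generalize b + c - kmin a c = x at *
  generalize a + b - kmin a c = z at *
  generalize kmin a c = y at *
  have hmin := min_cases (a : ℝ) c
  rw [← hm] at hmin hl hr
  have hx := lt_trichotomy (x : ℝ) 0
  have hy := lt_trichotomy (y : ℝ) 0
  have hz := lt_trichotomy (z : ℝ) 0
  rcases lt_trichotomy (a : ℝ) 0 with ha | ha | ha <;>
  rcases lt_trichotomy (b : ℝ) 0 with hb | hb | hb <;>
  rcases lt_trichotomy (c : ℝ) 0 with hc | hc | hc <;>
  rcases hmin with ⟨hmin, _⟩ | ⟨hmin, _⟩ <;>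
  rcases hy with hy | hy | hy <;> try (exfalso; linarith)
  all_goals
    rcases hx with hx | hx | hx <;> try (exfalso; linarith)
  all_goals
    rcases hz with hz | hz | hz <;> try (exfalso; linarith)
  all_goals
    simp only [chiGen_of_neg, chiGen_of_eq_zero, chiGen_of_pos, ha, hb, hc, hx, hy, hz,
      mul_zero, zero_mul, mul_one, one_mul, ← WithZero.coe_mul, genH_braid M h, genH_idem]

/-- The zero-subword map as a monoid homomorphism on all of `𝔘(K)`, with values in the
0-Hecke monoid with an absorbing element adjoined. -/
noncomputable def chiHom {I : Type*} (M : CoxeterMatrix I) (K : AddSubgroup ℝ) :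
    UK M K →* WithZero (Hecke M) :=
  Con.lift (conGen (UKRel M K)) (FreeMonoid.lift (chiGen M)) <| Con.conGen_le.2 <| by
    rintro _ _ (⟨i, j, h, a, b⟩ | ⟨i, j, h, a, b, c⟩ | ⟨i, a, b⟩)
    · simpa [Con.ker_rel] using chiGen_comm M h a b
    · simpa [Con.ker_rel] using chiGen_braid M h a b c
    · simpa [Con.ker_rel] using chiGen_idem M i a b

lemma chiHom_genU {I : Type*} (M : CoxeterMatrix I) (K : AddSubgroup ℝ) (i : I) (a : K) :
    chiHom M K (genU M K i a) = chiGen M (i, a) := rfl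

lemma chiHom_prodU {I : Type*} (M : CoxeterMatrix I) {K : AddSubgroup ℝ} (ω : List (I × K))
    (hω : ∀ p ∈ ω, 0 ≤ (p.2 : ℝ)) :
    chiHom M K (prodU M K ω) = (chiRep M ω : WithZero (Hecke M)) := by
  induction ω with
  | nil => exact map_one _
  | cons p ω ih =>
    have ih := ih fun q hq => hω q (List.mem_cons_of_mem _ hq)
    have hp := hω p List.mem_cons_self
    have hcons : prodU M K (p :: ω) = genU M K p.1 p.2 * prodU M K ω := by simp [prodU]
    rw [hcons, map_mul, chiHom_genU, ih]
    rcases hp.eq_or_lt with h0 | h0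
    · rw [chiGen_of_eq_zero M p.1 h0.symm, ← WithZero.coe_mul]
      simp [chiRep, zeroList, ← h0, prodH]
    · rw [chiGen_of_pos M p.1 h0, one_mul]
      simp [chiRep, zeroList, h0.ne']

/-- The zero-subword depends only on the element of `𝔘(K)`. -/
lemma chiRep_eq_of_prodU_eq {I : Type*} (M : CoxeterMatrix I) {K : AddSubgroup ℝ}
    {ω ω' : List (I × K)} (hω : ∀ p ∈ ω, 0 ≤ (p.2 : ℝ)) (hω' : ∀ p ∈ ω', 0 ≤ (p.2 : ℝ))
    (h : prodU M K ω = prodU M K ω') : chiRep M ω = chiRep M ω' := by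
  rw [← WithZero.coe_inj, ← chiHom_prodU M ω hω, h, chiHom_prodU M ω' hω']

open scoped Pointwise in
/-- The homomorphism from the 0-Hecke monoid to subsets of `W` sending `g_i` to `{1, s_i}`;
it sends `g_{i₁} ⋯ g_{i_n}` to the set of products of subwords. -/
def heckeSubwords {I W : Type*} [Group W] {M : CoxeterMatrix I} (cs : CoxeterSystem M W) :
    Hecke M →* Set W :=
  Con.lift (conGen (HeckeRel M)) (FreeMonoid.lift fun i => {1, cs.simple i}) <|
    Con.conGen_le.2 <| by
    rintro _ _ (⟨i, j, h⟩ | ⟨i, j, h⟩ | ⟨i⟩)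
    · have hc : cs.simple i * cs.simple j = cs.simple j * cs.simple i := by
        have := cs.wordProd_braidWord_eq i j
        rw [CoxeterSystem.braidWord, CoxeterSystem.braidWord, M.symmetric j i, h] at this
        simpa [CoxeterSystem.alternatingWord, CoxeterSystem.wordProd] using this
      ext w
      simp [Set.mem_mul, hc]
      tauto
    · have hc : cs.simple i * (cs.simple j * cs.simple i)
          = cs.simple j * (cs.simple i * cs.simple j) := by
        have := cs.wordProd_braidWord_eq i j
        rw [CoxeterSystem.braidWord, CoxeterSystem.braidWord, M.symmetric j i, h] at this
        simpa [CoxeterSystem.alternatingWord, CoxeterSystem.wordProd] using this.symm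
      ext w
      simp only [map_mul, FreeMonoid.lift_eval_of, Set.mem_mul, Set.mem_insert_iff,
        Set.mem_singleton_iff, or_and_right, exists_or, exists_eq_left, exists_eq_left', one_mul,
        mul_one, mul_assoc, hc, cs.simple_mul_simple_self]
      grind
    · ext w
      simp [Set.mem_mul]
      grind

open scoped Pointwise in
lemma heckeSubwords_prodH_cons {I W : Type*} [Group W] {M : CoxeterMatrix I}
    (cs : CoxeterSystem M W) (i : I) (l : List I) :
    heckeSubwords cs (prodH M (i :: l)) =
      {1, cs.simple i} * heckeSubwords cs (prodH M l) := by
  have hcons : prodH M (i :: l) = genH M i * prodH M l := by simp [prodH]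
  rw [hcons, map_mul]
  rfl

open scoped Pointwise in
lemma wordProd_mem_heckeSubwords {I W : Type*} [Group W] {M : CoxeterMatrix I}
    (cs : CoxeterSystem M W) (l : List I) :
    cs.wordProd l ∈ heckeSubwords cs (prodH M l) := by
  induction l with
  | nil => simp [prodH]
  | cons i l ih =>
    rw [heckeSubwords_prodH_cons, cs.wordProd_cons]
    exact Set.mul_mem_mul (by simp) ih

open scoped Pointwise in
lemma length_le_of_mem_heckeSubwords {I W : Type*} [Group W] {M : CoxeterMatrix I}
    (cs : CoxeterSystem M W) (l : List I) {w : W} (hw : w ∈ heckeSubwords cs (prodH M l)) :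
    cs.length w ≤ l.length := by
  induction l generalizing w with
  | nil =>
    have : w = 1 := by simpa [prodH] using hw
    simp [this]
  | cons i l ih =>
    rw [heckeSubwords_prodH_cons] at hw
    obtain ⟨u, hu, v, hv, rfl⟩ := hw
    have hv := ih hv
    rcases hu with rfl | rfl
    · simpa using hv.trans (Nat.le_succ _)
    · calc cs.length (cs.simple i * v) ≤ cs.length (cs.simple i) + cs.length v :=
            cs.length_mul_le _ _
        _ ≤ (i :: l).length := by rw [cs.length_simple, List.length_cons]; omega

/-- Moving an initial segment of a word of `w₀` to the end, twisted by conjugation by `w₀`,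
gives another word of `w₀`. -/
lemma IsRedWord.rotate {I W : Type*} [Group W] {M : CoxeterMatrix I} {cs : CoxeterSystem M W}
    {w₀ : W} {excl : I → I} (hexcl : ∀ i : I, cs.simple i * w₀ = w₀ * cs.simple (excl i))
    {l : List I} (hl : IsRedWord cs w₀ l) (n : ℕ) :
    IsRedWord cs w₀ (l.drop n ++ (l.take n).map excl) := by
  have hconj : ∀ m : List I, cs.wordProd m * w₀ = w₀ * cs.wordProd (m.map excl) := by
    intro m
    induction m with
    | nil => simp
    | cons i m ih =>
      rw [List.map_cons, cs.wordProd_cons, cs.wordProd_cons, mul_assoc, ih, ← mul_assoc, hexcl,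
        mul_assoc]
  refine ⟨?_, ?_⟩
  · have hsplit : cs.wordProd (l.take n) * cs.wordProd (l.drop n) = w₀ := by
      rw [← cs.wordProd_append, List.take_append_drop, hl.1]
    apply mul_left_cancel (a := cs.wordProd (l.take n))
    rw [cs.wordProd_append, ← mul_assoc, hsplit, hconj]
  · rw [← hl.2]
    simp only [List.length_append, List.length_drop, List.length_map, List.length_take]
    omega

/-- **11(a)** (Lusztig, "Half circles on flag manifolds over a semifield").
Fix a reduced word `(i₁, …, i_ν)` of `w₀` (here `l`, with the paper's `k ∈ {1, …, ν}`
corresponding to `kk = k - 1`), and for `i ∈ I` let `i^! ∈ I` (here `excl i`) be defined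
by `s_i w₀ = w₀ s_{i^!}`.  Then `(i_k, …, i_ν, i₁^!, …, i_{k-1}^!)` is a reduced word of
`w₀`.  If `H ∈ 𝒰(K₊)` satisfies `χ_{w₀}(H) = g_{i_{k-1}} ⋯ g_{i₂} g_{i₁}` and
`H = i_k^{c₁} i_{k+1}^{c₂} ⋯ (i_{k-1}^!)^{c_ν}` with coefficients in `K₊`, then
`c₁ > 0`, and `H̃ := i_k^{0} i_{k+1}^{c₂} ⋯ (i_{k-1}^!)^{c_ν}` lies in `𝒰(K₊)` and
satisfies `χ_{w₀}(H̃) = g_{i_k} g_{i_{k-1}} ⋯ g_{i₂} g_{i₁}`. -/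
theorem step_lemma
    {I W : Type*} [Finite I] [Nonempty I] [Group W] [Finite W]
    (M : CoxeterMatrix I) (hM : ∀ i j : I, i ≠ j → M i j = 2 ∨ M i j = 3)
    (cs : CoxeterSystem M W)
    (K : AddSubgroup ℝ) (hK : K ≠ ⊥)
    (ν : ℕ) (w₀ : W) (hw₀ : cs.length w₀ = ν) (hν : ∀ w : W, cs.length w ≤ ν)
    (excl : I → I) (hexcl : ∀ i : I, cs.simple i * w₀ = w₀ * cs.simple (excl i))
    (l : List I) (hl : IsRedWord cs w₀ l) (kk : ℕ) (hkk : kk < l.length)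
    (ω : List (I × K)) (hω : ω.map Prod.fst = l.drop kk ++ (l.take kk).map excl)
    (hpos : ∀ p ∈ ω, 0 ≤ (p.2 : ℝ))
    (H : UK M K) (hH : H = prodU M K ω)
    (hchi : ∀ ω' : List (I × K), IsRedWord cs w₀ (ω'.map Prod.fst) →
      (∀ p ∈ ω', 0 ≤ (p.2 : ℝ)) → H = prodU M K ω' →
      chiRep M ω' = prodH M ((l.take kk).reverse)) :
    IsRedWord cs w₀ (l.drop kk ++ (l.take kk).map excl) ∧
    ∃ (c₁ : K) (ωrest : List (I × K)),
      ω = (l.get ⟨kk, hkk⟩, c₁) :: ωrest ∧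
      0 < (c₁ : ℝ) ∧
      prodU M K ((l.get ⟨kk, hkk⟩, (0 : K)) :: ωrest) ∈ calUplus M K cs w₀ ∧
      ∀ ω' : List (I × K), IsRedWord cs w₀ (ω'.map Prod.fst) →
        (∀ p ∈ ω', 0 ≤ (p.2 : ℝ)) →
        prodU M K ((l.get ⟨kk, hkk⟩, (0 : K)) :: ωrest) = prodU M K ω' →
        chiRep M ω' = prodH M ((l.take (kk + 1)).reverse) := by
  have hred := hl.rotate hexcl kk
  refine ⟨hred, ?_⟩
  rw [List.drop_eq_getElem_cons hkk, List.cons_append] at hω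
  obtain ⟨⟨i, c₁⟩, ωrest, rfl, hi, hrest⟩ := List.map_eq_cons_iff.1 hω
  obtain rfl : i = l[kk] := hi
  have hc₁ : 0 ≤ (c₁ : ℝ) := hpos _ List.mem_cons_self
  have hpos' : ∀ p ∈ ωrest, 0 ≤ (p.2 : ℝ) := fun p hp => hpos p (List.mem_cons_of_mem _ hp)
  have hword : IsRedWord cs w₀ (l[kk] :: ωrest.map Prod.fst) := by
    rwa [hrest, ← List.cons_append, ← List.drop_eq_getElem_cons hkk]
  have hχ := hchi ((l[kk], c₁) :: ωrest) hword hpos hH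
  have htake : (l.take (kk + 1)).reverse = l[kk] :: (l.take kk).reverse := by
    rw [List.take_succ_eq_append_getElem hkk, List.reverse_append]
    rfl
  have hcons : ∀ m : List I, prodH M (l[kk] :: m) = genH M l[kk] * prodH M m := fun m => by
    simp [prodH]
  have hc : 0 < (c₁ : ℝ) := by
    refine hc₁.lt_of_ne fun h0 => ?_
    have habs : prodH M (l.take (kk + 1)).reverse = prodH M (l.take kk).reverse := by
      have hz : chiRep M ((l[kk], c₁) :: ωrest) = genH M l[kk] * chiRep M ωrest := by
        simp [chiRep, zeroList, ← h0, prodH]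
      rw [htake, hcons, ← hχ, hz, ← mul_assoc, genH_idem]
    have hmem := wordProd_mem_heckeSubwords cs (l.take (kk + 1)).reverse
    rw [habs] at hmem
    have hle := length_le_of_mem_heckeSubwords cs _ hmem
    have hlred : cs.IsReduced l := by rw [CoxeterSystem.IsReduced, hl.1, hl.2]
    have hlen : cs.IsReduced (l.take (kk + 1)).reverse :=
      (hlred.take (kk + 1)).reverse
    rw [hlen] at hle
    simp only [List.length_reverse, List.length_take] at hle
    omega
  have hpos₀ : ∀ p ∈ (l[kk], (0 : K)) :: ωrest, 0 ≤ (p.2 : ℝ) := by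
    rintro p (_ | ⟨_, hp⟩)
    · simp
    · exact hpos' p hp
  refine ⟨c₁, ωrest, rfl, hc, ⟨(l[kk], 0) :: ωrest, hword, hpos₀, rfl⟩, fun ω' _ hω' heq => ?_⟩
  rw [← chiRep_eq_of_prodU_eq M hpos₀ hω' heq, htake, hcons, ← hχ]
  simp [chiRep, zeroList, hc.ne', prodH]
end
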